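/- arXiv:1311.5691 — 2 statements merged into one kernel-verified Lean document; each statement's English description precedes it below -/
import Mathlib

section
/- Let G be a unicyclic graph (a connected simple graph on n ≥ 3 vertices with n edges). Then the inverse degree ρ(G) = Σ_{v} 1/deg(v) satisfies n/2 ≤ ρ(G) ≤ (n−2) + 1/(n−1). Moreover, the lower bound is attained if and only if G is isomorphic to the cycle C_n, and the upper bound is attained if and only if G is isomorphic to the graph S_n^+ obtained from the star S_n by joining two pendant vertices with an edge. -/
/-- The inverse degree of a graph on `Fin n`: the sum over all vertices of the
reciprocal of the degree. -/
noncomputable def inverseDegree {n : ℕ} (G : SimpleGraph (Fin n)) : ℝ :=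
  ∑ v : Fin n, (1 : ℝ) / ((G.neighborSet v).ncard : ℝ)

/-- The graph `S_n^+` obtained from the star `S_n` (center the vertex with value
`0`) by joining the two pendant vertices with values `1` and `2` with an edge. -/
def starPlus (n : ℕ) : SimpleGraph (Fin n) :=
  SimpleGraph.fromRel (fun a b => (a : ℕ) = 0 ∨ ((a : ℕ) = 1 ∧ (b : ℕ) = 2))

open SimpleGraph

lemma cyc_deg (m : ℕ) (v : Fin (m + 3)) :
    ((cycleGraph (m + 3)).neighborSet v).ncard = 2 := by
  rw [← cycleGraph_degree_three_le (v := v), ← card_neighborSet_eq_degree,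
    Set.ncard_eq_toFinset_card', Set.toFinset_card]

lemma sum_deg {n : ℕ} (G : SimpleGraph (Fin n)) :
    ∑ v, (G.neighborSet v).ncard = 2 * G.edgeSet.ncard := by
  classical
  have h := G.sum_degrees_eq_twice_card_edges
  rw [← coe_edgeFinset, Set.ncard_coe_finset, ← h]
  refine Finset.sum_congr rfl fun v _ => ?_
  rw [← card_neighborSet_eq_degree, Set.ncard_eq_toFinset_card', Set.toFinset_card]

lemma deg_le {n : ℕ} (G : SimpleGraph (Fin n)) (v : Fin n) :
    (G.neighborSet v).ncard ≤ n - 1 := by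
  have h : G.neighborSet v ⊆ {v}ᶜ := by
    intro w hw
    simp only [Set.mem_compl_iff, Set.mem_singleton_iff]
    rintro rfl
    exact G.loopless.irrefl _ hw
  have := Set.ncard_le_ncard h (Set.toFinite _)
  rw [Set.ncard_compl] at this
  simpa using this

lemma deg_pos {n : ℕ} (hn : 3 ≤ n) (G : SimpleGraph (Fin n)) (hc : G.Connected) (v : Fin n) :
    1 ≤ (G.neighborSet v).ncard := by
  have : Nontrivial (Fin n) := Fin.nontrivial_iff_two_le.2 (by omega)
  obtain ⟨w, hw⟩ := hc.preconnected.exists_adj_of_nontrivial v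
  exact (Set.ncard_pos (Set.toFinite _)).2 ⟨w, hw⟩

lemma exists_copy {n : ℕ} (G : SimpleGraph (Fin n)) (hc : G.Connected)
    (he : G.edgeSet.ncard = n) :
    ∃ m, Nonempty (Copy (cycleGraph (m + 3)) G) := by
  have h : ¬ G.IsAcyclic := by
    intro h
    have := (isTree_iff_connected_and_card.1 (isTree_iff G |>.2 ⟨hc, h⟩)).2
    rw [Nat.card_coe_set_eq, he] at this
    simp at this
  rw [isAcyclic_iff_free_cycleGraph] at h
  push Not at h
  obtain ⟨k, hk, h⟩ := h
  obtain ⟨m, rfl⟩ := Nat.exists_eq_add_of_le' hk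
  refine ⟨m, ?_⟩
  simpa [SimpleGraph.Free, IsContained] using h

lemma copy_sub {n m : ℕ} {G : SimpleGraph (Fin n)} (f : Copy (cycleGraph (m + 3)) G)
    (x : Fin (m + 3)) :
    f '' (cycleGraph (m + 3)).neighborSet x ⊆ G.neighborSet (f x) := by
  rintro _ ⟨y, hy, rfl⟩
  exact f.toHom.map_adj hy

lemma copy_card {n m : ℕ} {G : SimpleGraph (Fin n)} (f : Copy (cycleGraph (m + 3)) G)
    (x : Fin (m + 3)) :
    (f '' (cycleGraph (m + 3)).neighborSet x).ncard = 2 := by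
  rw [Set.ncard_image_of_injective _ (show Function.Injective f from f.injective), cyc_deg]

lemma iso_cycle {n : ℕ} (G : SimpleGraph (Fin n)) (hc : G.Connected)
    (he : G.edgeSet.ncard = n) (h2 : ∀ v, (G.neighborSet v).ncard = 2) :
    Nonempty (G ≃g cycleGraph n) := by
  obtain ⟨m, ⟨f⟩⟩ := exists_copy G hc he
  have key : ∀ x, f '' (cycleGraph (m + 3)).neighborSet x = G.neighborSet (f x) := fun x =>
    Set.eq_of_subset_of_ncard_le (copy_sub f x) (by rw [h2, copy_card]) (Set.toFinite _)
  have hs : Function.Surjective f := by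
    intro w
    obtain ⟨p⟩ := hc.preconnected (f 0) w
    have : ∀ {a b} (p : G.Walk a b), (∃ x, f x = a) → ∃ x, f x = b := by
      intro a b p
      induction p with
      | nil => exact id
      | cons h p ih =>
        rintro ⟨x, rfl⟩
        apply ih
        have h' := (key x).symm ▸ (show _ ∈ G.neighborSet (f x) from h)
        obtain ⟨y, _, hy⟩ := h'
        exact ⟨y, hy⟩
    exact this p ⟨0, rfl⟩
  have hcard := Fintype.card_of_bijective (f := f) ⟨f.injective, hs⟩
  simp only [Fintype.card_fin] at hcard
  subst hcard
  refine ⟨Iso.symm ⟨Equiv.ofBijective f ⟨f.injective, hs⟩, ?_⟩⟩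
  intro a b
  change G.Adj (f a) (f b) ↔ _
  constructor
  · intro h
    have h' := (key a).symm ▸ (show _ ∈ G.neighborSet (f a) from h)
    obtain ⟨y, hy, e⟩ := h'
    rw [← f.injective e]
    exact hy
  · exact fun h => f.toHom.map_adj h

lemma inv_iso {n : ℕ} {G H : SimpleGraph (Fin n)} (e : G ≃g H) :
    inverseDegree G = inverseDegree H := by
  unfold inverseDegree
  refine Fintype.sum_equiv e.toEquiv _ _ fun v => ?_
  have : (H.neighborSet (e v)) = e '' G.neighborSet v := by
    ext w
    constructor
    · intro h
      refine ⟨e.symm w, ?_, by simp⟩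
      rw [mem_neighborSet, ← e.map_adj_iff]
      simpa using h
    · rintro ⟨y, hy, rfl⟩
      exact e.map_adj_iff.2 hy
  have h2 : (H.neighborSet (e.toEquiv v)).ncard = (G.neighborSet v).ncard := by
    change (H.neighborSet (e v)).ncard = _
    rw [this, Set.ncard_image_of_injective _ e.injective]
  rw [h2]

lemma inv_cycle (m : ℕ) : inverseDegree (cycleGraph (m + 3)) = ((m + 3 : ℕ) : ℝ) / 2 := by
  unfold inverseDegree
  simp only [cyc_deg]
  simp
  ring

lemma inv_star (m : ℕ) : inverseDegree (starPlus (m + 3)) =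
    (((m + 3 : ℕ) : ℝ) - 2) + 1 / (((m + 3 : ℕ) : ℝ) - 1) := by
  have h0 : ((starPlus (m + 3)).neighborSet 0).ncard = m + 2 := by
    have : (starPlus (m + 3)).neighborSet 0 = {0}ᶜ := by
      ext w
      simp [starPlus, eq_comm]
    rw [this, Set.ncard_compl]
    simp
  have h1 : ((starPlus (m + 3)).neighborSet (Fin.succ 0)).ncard = 2 := by
    have : (starPlus (m + 3)).neighborSet (Fin.succ 0) = {0, 2} := by
      ext w
      have e2 : ((2 : Fin (m + 3)) : ℕ) = 2 := rfl
      simp only [starPlus, true_and, and_true, Fin.ext_iff, e2, mem_neighborSet, fromRel_adj, ne_eq, Fin.val_succ, Fin.val_zero, Set.mem_insert_iff, Set.mem_singleton_iff]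
      omega
    rw [this, Set.ncard_pair]
    intro h
    have h' := congrArg Fin.val h
    have e2 : ((2 : Fin (m + 3)) : ℕ) = 2 := rfl
    rw [e2] at h'
    simp at h'
  have h2 : ((starPlus (m + 3)).neighborSet (Fin.succ (Fin.succ 0))).ncard = 2 := by
    have : (starPlus (m + 3)).neighborSet (Fin.succ (Fin.succ 0)) = {0, 1} := by
      ext w
      have e2 : ((1 : Fin (m + 3)) : ℕ) = 1 := rfl
      simp only [starPlus, true_and, and_true, Fin.ext_iff, e2, mem_neighborSet, fromRel_adj, ne_eq, Fin.val_succ, Fin.val_zero, Set.mem_insert_iff, Set.mem_singleton_iff]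
      omega
    rw [this, Set.ncard_pair]
    simp [Fin.ext_iff]
  have h3 : ∀ i : Fin m,
      ((starPlus (m + 3)).neighborSet (Fin.succ (Fin.succ (Fin.succ i)))).ncard = 1 := by
    intro i
    have : (starPlus (m + 3)).neighborSet (Fin.succ (Fin.succ (Fin.succ i))) = {0} := by
      ext w
      simp only [starPlus, true_and, and_true, Fin.ext_iff, mem_neighborSet, fromRel_adj, ne_eq, Fin.val_succ, Fin.val_zero, Set.mem_insert_iff, Set.mem_singleton_iff]
      omega
    rw [this, Set.ncard_singleton]
  unfold inverseDegree
  rw [Fin.sum_univ_succ, Fin.sum_univ_succ, Fin.sum_univ_succ, h0, h1, h2]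
  simp only [h3]
  have : (m : ℝ) + 2 ≠ 0 := by positivity
  have h' : (m : ℝ) + 3 - 1 ≠ 0 := by
    have : (0 : ℝ) ≤ m := by positivity
    linarith
  simp
  field_simp
  ring

lemma three_vertices {n : ℕ} (G : SimpleGraph (Fin n)) (hc : G.Connected)
    (he : G.edgeSet.ncard = n) :
    3 ≤ (Finset.univ.filter fun v => 2 ≤ (G.neighborSet v).ncard).card := by
  obtain ⟨m, ⟨f⟩⟩ := exists_copy G hc he
  have : (Finset.univ.image f) ⊆
      (Finset.univ.filter fun v => 2 ≤ (G.neighborSet v).ncard) := by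
    intro v hv
    simp only [Finset.mem_image, Finset.mem_univ, true_and] at hv
    obtain ⟨x, rfl⟩ := hv
    simp only [Finset.mem_filter, Finset.mem_univ, true_and]
    rw [← copy_card f x]
    exact Set.ncard_le_ncard (copy_sub f x) (Set.toFinite _)
  have h := Finset.card_le_card this
  rw [Finset.card_image_of_injective _ (show Function.Injective f from f.injective)] at h
  simp at h
  omega

lemma iso_star {n : ℕ} (hn : 3 ≤ n) (G : SimpleGraph (Fin n)) (hc : G.Connected)
    (c a b : Fin n) (hca : c ≠ a) (hcb : c ≠ b) (hab : a ≠ b)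
    (hdc : (G.neighborSet c).ncard = n - 1)
    (hda : 2 ≤ (G.neighborSet a).ncard)
    (hd : ∀ v, 2 ≤ (G.neighborSet v).ncard → v = c ∨ v = a ∨ v = b) :
    Nonempty (G ≃g starPlus n) := by
  have hcadj : ∀ v, v ≠ c → G.Adj c v := by
    have h : G.neighborSet c = {c}ᶜ := by
      apply Set.eq_of_subset_of_ncard_le _ _ (Set.toFinite _)
      · intro w hw
        simp only [Set.mem_compl_iff, Set.mem_singleton_iff]
        rintro rfl
        exact G.loopless.irrefl _ hw
      · rw [Set.ncard_compl, hdc]; simp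
    intro v hv
    have : v ∈ G.neighborSet c := by rw [h]; exact hv
    exact this
  have hbig : ∀ x y, x ≠ c → y ≠ c → G.Adj x y → x = a ∨ x = b := by
    intro x y hx hy hxy
    have : 2 ≤ (G.neighborSet x).ncard := by
      have h : ({c, y} : Set (Fin n)) ⊆ G.neighborSet x := by
        rintro w (rfl | rfl)
        · exact (hcadj x hx).symm
        · exact hxy
      have := Set.ncard_le_ncard h (Set.toFinite _)
      rwa [Set.ncard_pair hy.symm] at this
    rcases hd x this with h | h
    · exact absurd h hx
    · exact h
  have habadj : G.Adj a b := by
    obtain ⟨y, hy, hyc⟩ := Set.exists_ne_of_one_lt_ncard (show 1 < (G.neighborSet a).ncard by omega) c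
    rcases hbig y a hyc hca.symm hy.symm with rfl | rfl
    · exact absurd hy (G.loopless.irrefl _)
    · exact hy
  have hadj : ∀ x y, G.Adj x y ↔ x ≠ y ∧ (x = c ∨ y = c ∨ (x = a ∧ y = b) ∨ (x = b ∧ y = a)) := by
    intro x y
    constructor
    · intro h
      refine ⟨h.ne, ?_⟩
      by_cases hx : x = c
      · exact Or.inl hx
      by_cases hy : y = c
      · exact Or.inr (Or.inl hy)
      have h1 := hbig x y hx hy h
      have h2 := hbig y x hy hx h.symm
      have := h.ne
      grind
    · rintro ⟨hne, rfl | rfl | ⟨rfl, rfl⟩ | ⟨rfl, rfl⟩⟩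
      · exact hcadj _ hne.symm
      · exact (hcadj _ hne).symm
      · exact habadj
      · exact habadj.symm
  obtain ⟨m, rfl⟩ := Nat.exists_eq_add_of_le' hn
  have e1 : ((1 : Fin (m + 3)) : ℕ) = 1 := rfl
  have e2 : ((2 : Fin (m + 3)) : ℕ) = 2 := rfl
  have e3 : 2 % (m + 3) = 2 := Nat.mod_eq_of_lt (by omega)
  obtain ⟨σ, hσ⟩ : ∃ σ : Equiv.Perm (Fin (m + 3)), σ 0 = c ∧ σ 1 = a ∧ σ 2 = b := by
    have i1 : Function.Injective ![(0 : Fin (m + 3)), 1, 2] := by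
      intro i j h
      fin_cases i <;> fin_cases j <;> simp [Fin.ext_iff, e3] at h ⊢
    have i2 : Function.Injective ![c, a, b] := by
      intro i j h
      fin_cases i <;> fin_cases j <;> simp_all
    have := Equiv.Perm.isMultiplyPretransitive (Fin (m + 3)) 3
    obtain ⟨σ, h⟩ := this.exists_smul_eq ⟨_, i1⟩ ⟨_, i2⟩
    have h' := fun i => DFunLike.congr_fun h i
    exact ⟨σ, h' 0, h' 1, h' 2⟩
  obtain ⟨rfl, rfl, rfl⟩ := hσ
  refine ⟨Iso.symm ⟨σ, ?_⟩⟩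
  intro x y
  rw [hadj]
  simp only [σ.injective.eq_iff, ne_eq, starPlus, fromRel_adj, Fin.ext_iff, e1, e2, Fin.val_zero]
  tauto

theorem unicyclic_inverse_degree_bounds (n : ℕ) (hn : 3 ≤ n)
    (G : SimpleGraph (Fin n)) (hconn : G.Connected)
    (hedges : G.edgeSet.ncard = n) :
    ((n : ℝ) / 2 ≤ inverseDegree G ∧
      inverseDegree G ≤ ((n : ℝ) - 2) + 1 / ((n : ℝ) - 1)) ∧
    (inverseDegree G = (n : ℝ) / 2 ↔
      Nonempty (G ≃g SimpleGraph.cycleGraph n)) ∧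
    (inverseDegree G = ((n : ℝ) - 2) + 1 / ((n : ℝ) - 1) ↔
      Nonempty (G ≃g starPlus n)) := by
  have hpos := deg_pos hn G hconn
  have hle := deg_le G
  have hsum := sum_deg G
  have h3 := three_vertices G hconn hedges
  rw [hedges] at hsum
  have hsumR : ∑ v, ((G.neighborSet v).ncard : ℝ) = 2 * n := by exact_mod_cast hsum
  have hnR : (3 : ℝ) ≤ n := by exact_mod_cast hn
  -- lower bound
  have hlow : ∀ v : Fin n, 1 - ((G.neighborSet v).ncard : ℝ) / 4 ≤
      1 / ((G.neighborSet v).ncard : ℝ) := by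
    intro v
    have : (1 : ℝ) ≤ (G.neighborSet v).ncard := by exact_mod_cast hpos v
    rw [le_div_iff₀ (by linarith)]
    nlinarith [sq_nonneg (((G.neighborSet v).ncard : ℝ) - 2)]
  have hlows : ∑ v : Fin n, (1 - ((G.neighborSet v).ncard : ℝ) / 4) = n / 2 := by
    rw [Finset.sum_sub_distrib, ← Finset.sum_div, hsumR]
    simp
    ring
  -- upper bound
  set S := Finset.univ.filter fun v => 2 ≤ (G.neighborSet v).ncard with hS
  let g : Fin n → ℝ := fun v => (1 / 2 - (((G.neighborSet v).ncard : ℝ) - 2) / (2 * (n - 1))) +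
    (n - 2) / (2 * (n - 1)) - if v ∈ S then ((n : ℝ) - 2) / (2 * (n - 1)) else 0
  have hup : ∀ v : Fin n, 1 / ((G.neighborSet v).ncard : ℝ) ≤ g v := by
    intro v
    have h1 : (1 : ℝ) ≤ (G.neighborSet v).ncard := by exact_mod_cast hpos v
    have h2 : ((G.neighborSet v).ncard : ℝ) ≤ n - 1 := by
      have : (G.neighborSet v).ncard + 1 ≤ n := by have := hle v; omega
      have : ((G.neighborSet v).ncard : ℝ) + 1 ≤ n := by exact_mod_cast this
      linarith
    have hn1 : (0 : ℝ) < n - 1 := by linarith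
    by_cases hv : v ∈ S
    · have h4 : (2 : ℝ) ≤ (G.neighborSet v).ncard := by
        exact_mod_cast (Finset.mem_filter.1 hv).2
      simp only [g, if_pos hv]
      rw [← sub_nonneg]
      have : (1 / 2 - (((G.neighborSet v).ncard : ℝ) - 2) / (2 * (n - 1))) +
        (n - 2) / (2 * (n - 1)) - ((n : ℝ) - 2) / (2 * (n - 1)) -
          1 / ((G.neighborSet v).ncard : ℝ) = (((G.neighborSet v).ncard : ℝ) - 2) *
          ((n - 1) - ((G.neighborSet v).ncard : ℝ)) /
          (2 * (n - 1) * ((G.neighborSet v).ncard : ℝ)) := by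
        field_simp
        ring
      rw [this]
      apply div_nonneg
      · exact mul_nonneg (by linarith) (by linarith)
      · positivity
    · have h4 : (G.neighborSet v).ncard = 1 := by
        have := hpos v
        simp only [hS, Finset.mem_filter, Finset.mem_univ, true_and, not_le] at hv
        omega
      simp only [g, if_neg hv, h4]
      apply le_of_eq
      push_cast
      field_simp
      ring
  have hgs : ∑ v, g v = n / 2 + (n - S.card) * ((n - 2) / (2 * (n - 1))) := by
    simp only [g]
    rw [Finset.sum_sub_distrib, Finset.sum_add_distrib, Finset.sum_sub_distrib,
      ← Finset.sum_div _ (fun v : Fin n => ((G.neighborSet v).ncard : ℝ) - 2),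
      Finset.sum_sub_distrib, hsumR]
    simp
    ring
  have hval : ((n : ℝ) - 2) + 1 / ((n : ℝ) - 1) =
      n / 2 + (n - 3) * ((n - 2) / (2 * (n - 1))) := by
    have hn1 : (n : ℝ) - 1 ≠ 0 := by intro h; linarith
    field_simp
    ring
  have hq : (0 : ℝ) < (n - 2) / (2 * (n - 1)) := div_pos (by linarith) (by linarith)
  have h3R : (3 : ℝ) ≤ S.card := by exact_mod_cast h3
  have hge : ∑ v, g v ≤ ((n : ℝ) - 2) + 1 / ((n : ℝ) - 1) := by
    rw [hgs, hval]
    nlinarith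
  have hig : inverseDegree G ≤ ∑ v, g v := Finset.sum_le_sum fun v _ => hup v
  refine ⟨⟨?_, hig.trans hge⟩, ⟨?_, ?_⟩, ⟨?_, ?_⟩⟩
  · rw [← hlows]
    exact Finset.sum_le_sum fun v _ => hlow v
  · intro h
    rw [← hlows] at h
    have h' := (Finset.sum_eq_sum_iff_of_le fun v _ => hlow v).1 h.symm
    refine iso_cycle G hconn hedges fun v => ?_
    have hv := h' v (Finset.mem_univ _)
    have h1 : (1 : ℝ) ≤ (G.neighborSet v).ncard := by exact_mod_cast hpos v
    rw [eq_div_iff (by linarith)] at hv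
    have : (((G.neighborSet v).ncard : ℝ) - 2) ^ 2 = 0 := by linarith
    have := pow_eq_zero_iff (two_ne_zero) |>.1 this
    have : ((G.neighborSet v).ncard : ℝ) = 2 := by linarith
    exact_mod_cast this
  · rintro ⟨e⟩
    rw [inv_iso e]
    obtain ⟨m, rfl⟩ := Nat.exists_eq_add_of_le' hn
    exact inv_cycle m
  · intro h
    have hc3 : S.card = 3 := by
      have h5 : ((n : ℝ) - 2) + 1 / ((n : ℝ) - 1) ≤ ∑ v, g v := h ▸ hig
      rw [hgs, hval] at h5
      have : (S.card : ℝ) ≤ 3 := by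
        by_contra hlt
        push Not at hlt
        nlinarith
      have : S.card ≤ 3 := by exact_mod_cast this
      omega
    have hEq : inverseDegree G = ∑ v, g v := le_antisymm hig (h ▸ hge)
    have h' := (Finset.sum_eq_sum_iff_of_le fun v _ => hup v).1 hEq
    have hdeg : ∀ v ∈ S, (G.neighborSet v).ncard = 2 ∨ (G.neighborSet v).ncard = n - 1 := by
      intro v hv
      have hv' := h' v (Finset.mem_univ _)
      have h1 : (1 : ℝ) ≤ (G.neighborSet v).ncard := by exact_mod_cast hpos v
      simp only [g, if_pos hv] at hv'
      have hn1 : (n : ℝ) - 1 ≠ 0 := by intro h; linarith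
      have hz : (((G.neighborSet v).ncard : ℝ) - 2) *
          ((n - 1) - ((G.neighborSet v).ncard : ℝ)) = 0 := by
        field_simp at hv'
        linarith
      rcases mul_eq_zero.1 hz with h | h
      · left
        have : ((G.neighborSet v).ncard : ℝ) = 2 := by linarith
        exact_mod_cast this
      · right
        have : ((G.neighborSet v).ncard : ℝ) + 1 = n := by linarith
        have : (G.neighborSet v).ncard + 1 = n := by exact_mod_cast this
        omega
    have hsumS : ∑ v ∈ S, (G.neighborSet v).ncard = n + 3 := by
      have h6 := Finset.sum_add_sum_compl S (fun v => (G.neighborSet v).ncard)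
      have h7 : ∑ v ∈ Sᶜ, (G.neighborSet v).ncard = n - 3 := by
        rw [Finset.sum_congr rfl (g := fun _ => 1), Finset.sum_const, Finset.card_compl, hc3]
        · simp
        · intro v hv
          have := hpos v
          simp only [hS, Finset.mem_compl, Finset.mem_filter, Finset.mem_univ, true_and, not_le] at hv
          omega
      omega
    have hcen : ∃ c ∈ S, (G.neighborSet c).ncard = n - 1 := by
      by_contra hno
      push Not at hno
      have h2 : ∀ v ∈ S, (G.neighborSet v).ncard = 2 := fun v hv =>
        (hdeg v hv).resolve_right (hno v hv)
      rw [Finset.sum_congr rfl h2, Finset.sum_const, hc3] at hsumS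
      obtain ⟨v, hv⟩ : S.Nonempty := Finset.card_pos.1 (by omega)
      apply hno v hv
      rw [h2 v hv]
      simp at hsumS
      omega
    obtain ⟨c, hcS, hcd⟩ := hcen
    have h8 : (S.erase c).card = 2 := by rw [Finset.card_erase_of_mem hcS, hc3]
    obtain ⟨a, b, hab, hSe⟩ := Finset.card_eq_two.1 h8
    have ha : a ∈ S.erase c := by rw [hSe]; simp
    have hb : b ∈ S.erase c := by rw [hSe]; simp
    refine iso_star hn G hconn c a b (Finset.ne_of_mem_erase ha).symm
      (Finset.ne_of_mem_erase hb).symm hab hcd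
      (Finset.mem_filter.1 (Finset.mem_of_mem_erase ha)).2 ?_
    intro v hv
    by_cases hvc : v = c
    · exact Or.inl hvc
    · right
      have : v ∈ S.erase c := Finset.mem_erase.2 ⟨hvc, by simp [hS, hv]⟩
      rw [hSe] at this
      simpa using this
  · rintro ⟨e⟩
    rw [inv_iso e]
    obtain ⟨m, rfl⟩ := Nat.exists_eq_add_of_le' hn
    exact inv_star m
end

section
/- Let G be a tetracyclic graph (a connected simple graph on n ≥ 6 vertices with n+3 edges). Then the inverse degree ρ(G) = Σ_{v} 1/deg(v) satisfies (n−2)/2 ≤ ρ(G) ≤ (n−5) + 1/(n−1) + 17/12; the lower bound is attained by a graph with degree sequence (3^6, 2^{n−6}) and the upper bound by a graph with degree sequence (n−1, 4, 3^2, 2, 1^{n−5}). -/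
/-- `d` (0-indexed) is the degree sequence of `G`: some relabelling of the
vertices realizes the degrees `d 0, …, d (n-1)`. -/
def IsDegreeSequence {n : ℕ} (G : SimpleGraph (Fin n)) (d : ℕ → ℕ) : Prop :=
  ∃ σ : Equiv.Perm (Fin n), ∀ i : Fin n, (G.neighborSet (σ i)).ncard = d (i : ℕ)

open SimpleGraph

lemma ncard_nbr {V : Type} (G : SimpleGraph V) (v : V) [Fintype (G.neighborSet v)] :
    (G.neighborSet v).ncard = G.degree v := by
  rw [Set.ncard_eq_toFinset_card']; rfl

lemma ncard_nbr_sum {V : Type} [Fintype V] (G : SimpleGraph V) :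
    ∑ v, (G.neighborSet v).ncard = 2 * G.edgeSet.ncard := by
  classical
  rw [Set.ncard_eq_toFinset_card' G.edgeSet]
  simp_rw [ncard_nbr]
  exact G.sum_degrees_eq_twice_card_edges

lemma ncard_nbr_pos {V : Type} [Finite V] [Nontrivial V] {G : SimpleGraph V}
    (h : G.Connected) (v : V) : 1 ≤ (G.neighborSet v).ncard := by
  classical
  have := Fintype.ofFinite V
  rw [ncard_nbr]
  exact h.preconnected.degree_pos_of_nontrivial v

lemma ncard_nbr_lt {V : Type} [Fintype V] (G : SimpleGraph V) (v : V) :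
    (G.neighborSet v).ncard + 1 ≤ Fintype.card V := by
  classical
  rw [ncard_nbr]
  exact G.degree_lt_card_verts v

/-- Effect of removing a leaf `v` attached to `w` on a sum of a function of the degrees. -/
lemma leaf_sum {V : Type} [Fintype V] (G : SimpleGraph V) (v w : V)
    [Fintype ({v}ᶜ : Set V)]
    (hv : G.neighborSet v = {w}) (F : ℕ → ℝ) :
    ∑ x, F ((G.neighborSet x).ncard) =
      F 1 + F ((G.neighborSet w).ncard) - F ((G.neighborSet w).ncard - 1) +
      ∑ x : ({v}ᶜ : Set V), F (((G.induce {v}ᶜ).neighborSet x).ncard) := by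
  classical
  have hadj : G.Adj v w := by
    have : w ∈ G.neighborSet v := by simp [hv]
    exact this
  have hdeg : ∀ x : ({v}ᶜ : Set V), ((G.induce {v}ᶜ).neighborSet x).ncard =
      (G.neighborSet x.1 \ {v}).ncard := by
    intro x
    rw [← Set.ncard_image_of_injective _ Subtype.val_injective]
    congr 1
    ext y
    simp only [Set.mem_image, mem_neighborSet, Subtype.exists, Set.mem_sdiff]
    constructor
    · rintro ⟨a, ha, h1, rfl⟩
      exact ⟨h1, ha⟩
    · rintro ⟨h1, h2⟩
      exact ⟨y, h2, h1, rfl⟩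
  have h1 : ∑ x : ({v}ᶜ : Set V), F (((G.induce {v}ᶜ).neighborSet x).ncard) =
      ∑ x ∈ Finset.univ.erase v, F ((G.neighborSet x \ {v}).ncard) := by
    simp_rw [hdeg]
    rw [Finset.sum_subtype (Finset.univ.erase v) (p := fun x => x ∈ ({v}ᶜ : Set V)) (by simp)
      (fun x => F ((G.neighborSet x \ {v}).ncard))]
    
  have hw : w ∈ Finset.univ.erase v := by simp [hadj.ne']
  rw [h1, ← Finset.add_sum_erase _ _ (Finset.mem_univ v), ← Finset.add_sum_erase _ _ hw,
    ← Finset.add_sum_erase _ (fun x => F ((G.neighborSet x \ {v}).ncard)) hw]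
  have h2 : ∑ x ∈ (Finset.univ.erase v).erase w, F ((G.neighborSet x \ {v}).ncard) =
      ∑ x ∈ (Finset.univ.erase v).erase w, F ((G.neighborSet x).ncard) := by
    apply Finset.sum_congr rfl
    intro x hx
    simp only [Finset.mem_erase] at hx
    rw [Set.sdiff_singleton_eq_self]
    intro h
    have : x ∈ G.neighborSet v := G.adj_symm h
    rw [hv] at this
    exact hx.1 this
  rw [h2, Set.ncard_sdiff_singleton_of_mem (show v ∈ G.neighborSet w from hadj.symm), hv]
  simp only [Set.ncard_singleton]
  ring

lemma base_five {V : Type} [Fintype V] (G : SimpleGraph V) (hc : Fintype.card V = 5)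
    (hs : ∑ v, (G.neighborSet v).ncard = 16) :
    ∑ v, (1 : ℝ) / ((G.neighborSet v).ncard : ℝ) ≤ 5 / 3 := by
  classical
  have hcd : ∀ v, Gᶜ.degree v + (G.neighborSet v).ncard = 4 := by
    intro v
    have := ncard_nbr_lt G v
    rw [degree_compl, ← ncard_nbr]
    omega
  have hsc : ∑ v, Gᶜ.degree v = 4 := by
    have h := Finset.sum_congr (rfl : (Finset.univ : Finset V) = _) (fun v _ => hcd v)
    rw [Finset.sum_add_distrib, hs] at h
    simp [hc] at h
    omega
  have hE : Gᶜ.edgeFinset.card = 2 := by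
    have := Gᶜ.sum_degrees_eq_twice_card_edges
    omega
  have hinc : ∀ v, (Gᶜ.incidenceFinset v) ⊆ Gᶜ.edgeFinset := fun v =>
    Gᶜ.incidenceFinset_subset v
  have hle : ∀ v, Gᶜ.degree v ≤ 2 := by
    intro v
    rw [← hE, ← card_incidenceFinset_eq_degree]
    exact Finset.card_le_card (hinc v)
  have huniq : (Finset.univ.filter (fun v => Gᶜ.degree v = 2)).card ≤ 1 := by
    rw [Finset.card_le_one]
    intro a ha b hb
    simp only [Finset.mem_filter, Finset.mem_univ, true_and] at ha hb
    by_contra hab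
    have key : ∀ v, Gᶜ.degree v = 2 → Gᶜ.incidenceFinset v = Gᶜ.edgeFinset := by
      intro v hv
      apply Finset.eq_of_subset_of_card_le (hinc v)
      rw [hE, card_incidenceFinset_eq_degree, hv]
    have h1 : Gᶜ.edgeFinset ⊆ {s(a, b)} := by
      intro e he
      have ea : e ∈ Gᶜ.incidenceFinset a := by rw [key a ha]; exact he
      have eb : e ∈ Gᶜ.incidenceFinset b := by rw [key b hb]; exact he
      rw [mem_incidenceFinset] at ea eb
      have := Gᶜ.incidenceSet_inter_incidenceSet_subset hab ⟨ea, eb⟩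
      simpa using this
    have := Finset.card_le_card h1
    simp [hE] at this
  have hpt : ∀ v, (1 : ℝ) / ((G.neighborSet v).ncard : ℝ) ≤
      1 / 4 + (Gᶜ.degree v : ℝ) / 12 + (if Gᶜ.degree v = 2 then 1 else 0) / 12 := by
    intro v
    have h1 := hcd v
    have h2 := hle v
    generalize Gᶜ.degree v = c at *
    generalize (G.neighborSet v).ncard = d at *
    obtain rfl : d = 4 - c := by omega
    interval_cases c <;> norm_num
  refine (Finset.sum_le_sum (fun v _ => hpt v)).trans ?_
  rw [Finset.sum_add_distrib, Finset.sum_add_distrib,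
    ← Finset.sum_div _ (fun v => (Gᶜ.degree v : ℝ)),
    ← Finset.sum_div _ (fun v => (if Gᶜ.degree v = 2 then (1 : ℝ) else 0)),
    Finset.sum_boole, ← Nat.cast_sum, hsc]
  simp only [Finset.sum_const, Finset.card_univ, hc]
  have : ((Finset.univ.filter (fun v => Gᶜ.degree v = 2)).card : ℝ) ≤ 1 := by exact_mod_cast huniq
  norm_num
  linarith

lemma upper (m : ℕ) : ∀ (V : Type) [Fintype V] (G : SimpleGraph V),
    Fintype.card V = m + 5 → G.Connected →
    ∑ v, (G.neighborSet v).ncard = 2 * m + 16 →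
    ∑ v, (1 : ℝ) / ((G.neighborSet v).ncard : ℝ) ≤ m + 1 / (m + 4) + 17 / 12 := by
  induction m with
  | zero =>
    intro V _ G hc _ hs
    have := base_five G (by simpa using hc) (by simpa using hs)
    norm_num at this ⊢
    linarith
  | succ m ih =>
    intro V _ G hc hconn hs
    classical
    have : Nontrivial V := by
      rw [← Fintype.one_lt_card_iff_nontrivial]; omega
    have hpos := ncard_nbr_pos hconn
    by_cases hl : ∃ v, (G.neighborSet v).ncard = 1
    · obtain ⟨v, hv⟩ := hl
      obtain ⟨w, hw⟩ := Set.ncard_eq_one.mp hv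
      have hconn' : (G.induce {v}ᶜ).Connected :=
        hconn.induce_compl_singleton_of_degree_eq_one (by rw [← ncard_nbr]; exact hv)
      have hc' : Fintype.card ({v}ᶜ : Set V) = m + 5 := by
        rw [Fintype.card_compl_set]; simp [hc]
      have : Nontrivial ({v}ᶜ : Set V) := by
        rw [← Fintype.one_lt_card_iff_nontrivial]; omega
      have e1 := leaf_sum G v w hw (fun k => (k : ℝ))
      have e2 := leaf_sum G v w hw (fun k => (1 : ℝ) / (k : ℝ))
      have hd1 := hpos w
      have hd3 := ncard_nbr_lt G w
      have hd2 : 2 ≤ (G.neighborSet w).ncard := by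
        have hadj : G.Adj v w := by
          have : w ∈ G.neighborSet v := by simp [hw]
          exact this
        have h0 := ncard_nbr_pos hconn' ⟨w, by simpa using hadj.ne'⟩
        replace h0 := Set.nonempty_of_ncard_ne_zero (Nat.one_le_iff_ne_zero.mp h0)
        obtain ⟨y, hy⟩ := h0
        have hy' : G.Adj w y.1 := hy
        have hsub : ({v, y.1} : Set V) ⊆ G.neighborSet w := by
          intro z hz
          rcases hz with rfl | rfl
          · exact hadj.symm
          · exact hy'
        have := Set.ncard_le_ncard hsub
        rwa [Set.ncard_pair (fun h => y.2 h.symm)] at this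
      generalize (G.neighborSet w).ncard = d at *
      simp only [← Nat.cast_sum, hs] at e1
      have hs' : ∑ x, ((G.induce {v}ᶜ).neighborSet x).ncard = 2 * m + 16 := by
        push_cast [Nat.cast_sub hd1] at e1
        have : ((∑ x, ((G.induce {v}ᶜ).neighborSet x).ncard : ℕ) : ℝ) = (2 * m + 16 : ℕ) := by
          push_cast
          linarith
        exact_mod_cast this
      have hi := ih _ (G.induce {v}ᶜ) hc' hconn' hs'
      rw [e2]
      obtain ⟨k, rfl⟩ : ∃ k, d = k + 2 := ⟨d - 2, by omega⟩
      have hk : (k : ℝ) ≤ m + 3 := by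
        have : k ≤ m + 3 := by omega
        exact_mod_cast this
      have hk0 : (0 : ℝ) ≤ k := Nat.cast_nonneg k
      have hm0 : (0 : ℝ) ≤ m := Nat.cast_nonneg m
      have a1 : (1 : ℝ) / (k + 1) - 1 / (k + 2) = 1 / ((k + 1) * (k + 2)) := by
        field_simp; ring
      have a2 : (1 : ℝ) / (m + 4) - 1 / (m + 5) = 1 / ((m + 4) * (m + 5)) := by
        field_simp; ring
      have a3 : (1 : ℝ) / ((m + 4) * (m + 5)) ≤ 1 / ((k + 1) * (k + 2)) := by
        apply one_div_le_one_div_of_le (by positivity)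
        apply mul_le_mul <;> first | linarith | positivity
      have e : k + 2 - 1 = k + 1 := rfl
      rw [e]
      push_cast
      rw [show (m : ℝ) + 1 + 4 = m + 5 by ring]
      linarith
    · push Not at hl
      have hge : ∀ v, 2 ≤ (G.neighborSet v).ncard := by
        intro v
        have := hpos v
        have := hl v
        omega
      rcases Nat.lt_or_ge m 1 with h | h
      · obtain rfl : m = 0 := by omega
        have hpt : ∀ v, (1 : ℝ) / ((G.neighborSet v).ncard : ℝ) ≤
            7 / 10 - ((G.neighborSet v).ncard : ℝ) / 10 := by
          intro v
          have h1 := hge v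
          have h2 := ncard_nbr_lt G v
          generalize (G.neighborSet v).ncard = d at *
          have : d ≤ 5 := by omega
          interval_cases d <;> norm_num
        refine (Finset.sum_le_sum (fun v _ => hpt v)).trans ?_
        rw [Finset.sum_sub_distrib,
      ← Finset.sum_div _ (fun v => ((G.neighborSet v).ncard : ℝ)), ← Nat.cast_sum, hs]
        simp [hc]
        norm_num
      · have hpt : ∀ v, (1 : ℝ) / ((G.neighborSet v).ncard : ℝ) ≤ 1 / 2 := by
          intro v
          apply one_div_le_one_div_of_le (by norm_num)
          exact_mod_cast hge v
        refine (Finset.sum_le_sum (fun v _ => hpt v)).trans ?_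
        simp only [Finset.sum_const, Finset.card_univ, hc, nsmul_eq_mul]
        push_cast
        have hm : (1 : ℝ) ≤ m := by exact_mod_cast h
        rcases Nat.lt_or_ge m 2 with h' | h'
        · obtain rfl : m = 1 := by omega
          norm_num
        · have hm : (2 : ℝ) ≤ m := by exact_mod_cast h'
          have : (0 : ℝ) ≤ 1 / (m + 1 + 4) := by positivity
          linarith

lemma lower {V : Type} [Fintype V] (G : SimpleGraph V) (hpos : ∀ v, 1 ≤ (G.neighborSet v).ncard)
    (hs : ∑ v, (G.neighborSet v).ncard = 2 * (Fintype.card V + 3)) :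
    ((Fintype.card V : ℝ) - 2) / 2 ≤ ∑ v, (1 : ℝ) / ((G.neighborSet v).ncard : ℝ) := by
  have hpt : ∀ v, 5 / 6 - ((G.neighborSet v).ncard : ℝ) / 6 ≤
      (1 : ℝ) / ((G.neighborSet v).ncard : ℝ) := by
    intro v
    have h1 := hpos v
    generalize (G.neighborSet v).ncard = d at *
    rcases Nat.lt_or_ge d 3 with h | h
    · interval_cases d <;> norm_num
    · have h3 : (3 : ℝ) ≤ d := by exact_mod_cast h
      rw [le_div_iff₀ (by linarith)]
      nlinarith
  refine le_trans ?_ (Finset.sum_le_sum (fun v _ => hpt v))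
  rw [Finset.sum_sub_distrib,
      ← Finset.sum_div _ (fun v => ((G.neighborSet v).ncard : ℝ)), ← Nat.cast_sum, hs]
  simp
  linarith

lemma edges_of_deg {n : ℕ} (H : SimpleGraph (Fin n)) (d : ℕ → ℕ)
    (hd : ∀ i : Fin n, (H.neighborSet i).ncard = d i)
    (hs : ∑ i ∈ Finset.range n, d i = 2 * (n + 3)) : H.edgeSet.ncard = n + 3 := by
  have h := ncard_nbr_sum H
  simp_rw [hd] at h
  rw [Fin.sum_univ_eq_sum_range d n] at h
  omega

lemma inv_of_deg {n : ℕ} (H : SimpleGraph (Fin n)) (d : ℕ → ℕ)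
    (hd : ∀ i : Fin n, (H.neighborSet i).ncard = d i) :
    inverseDegree H = ∑ i ∈ Finset.range n, (1 : ℝ) / (d i : ℝ) := by
  unfold inverseDegree
  simp_rw [hd]
  rw [Fin.sum_univ_eq_sum_range (fun i => (1 : ℝ) / (d i : ℝ)) n]

/-- chords `i ~ i+3` among the first six vertices. -/
def chordGraph (n : ℕ) : SimpleGraph (Fin n) where
  Adj u v := u.1 < 6 ∧ v.1 < 6 ∧ (u.1 = v.1 + 3 ∨ v.1 = u.1 + 3)
  symm := ⟨fun _ _ h => ⟨h.2.1, h.1, h.2.2.symm⟩⟩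
  loopless := ⟨fun u h => by omega⟩

lemma chord_deg (k : ℕ) (i : Fin (k + 6)) :
    ((cycleGraph (k + 6) ⊔ chordGraph (k + 6)).neighborSet i).ncard = if i.1 < 6 then 3 else 2 := by
  have hcyc : ((cycleGraph (k + 6)).neighborSet i).ncard = 2 := by
    classical
    rw [ncard_nbr]
    exact cycleGraph_degree_three_le (n := k + 3)
  have hun : (cycleGraph (k + 6) ⊔ chordGraph (k + 6)).neighborSet i =
      (cycleGraph (k + 6)).neighborSet i ∪ (chordGraph (k + 6)).neighborSet i := by
    ext x; simp
  split_ifs with h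
  · obtain ⟨j, hj6, hj⟩ : ∃ j : ℕ, j < 6 ∧ (i.1 = j + 3 ∨ j = i.1 + 3) := by
      by_cases h3 : i.1 < 3
      · exact ⟨i.1 + 3, by omega, by omega⟩
      · exact ⟨i.1 - 3, by omega, by omega⟩
    have hch : (chordGraph (k + 6)).neighborSet i = {(⟨j, by omega⟩ : Fin (k + 6))} := by
      ext x
      simp only [mem_neighborSet, chordGraph, Set.mem_singleton_iff, Fin.ext_iff]
      omega
    rw [hun, hch, Set.ncard_union_eq, hcyc, Set.ncard_singleton]
    rw [Set.disjoint_singleton_right, mem_neighborSet, cycleGraph_adj']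
    rintro (h1 | h1)
    · rw [Fin.sub_def] at h1
      simp only at h1
      rcases hj with hj | hj
      · rw [show k + 6 - j + i.1 = 3 + (k + 6) by omega, Nat.add_mod_right,
          Nat.mod_eq_of_lt (by omega)] at h1
        omega
      · rw [Nat.mod_eq_of_lt (by omega)] at h1
        omega
    · rw [Fin.sub_def] at h1
      simp only at h1
      rcases hj with hj | hj
      · rw [Nat.mod_eq_of_lt (by omega)] at h1
        omega
      · rw [show k + 6 - i.1 + j = 3 + (k + 6) by omega, Nat.add_mod_right,
          Nat.mod_eq_of_lt (by omega)] at h1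
        omega
  · have hch : (chordGraph (k + 6)).neighborSet i = ∅ := by
      ext x
      simp only [mem_neighborSet, chordGraph, Set.mem_empty_iff_false, iff_false]
      omega
    rw [hun, hch, Set.union_empty, hcyc]

/-- a dominating vertex `0` together with edges `12, 13, 14, 23`. -/
def fanGraph (n : ℕ) : SimpleGraph (Fin n) where
  Adj u v := u.1 ≠ v.1 ∧ (u.1 = 0 ∨ v.1 = 0 ∨ (u.1 = 1 ∧ v.1 ≤ 4) ∨ (v.1 = 1 ∧ u.1 ≤ 4) ∨
    (u.1 = 2 ∧ v.1 = 3) ∨ (u.1 = 3 ∧ v.1 = 2))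
  symm := ⟨fun _ _ h => by omega⟩
  loopless := ⟨fun u h => by omega⟩

lemma fan_conn (k : ℕ) : (fanGraph (k + 6)).Connected := by
  rw [connected_iff_exists_forall_reachable]
  refine ⟨0, fun w => ?_⟩
  by_cases h : w = 0
  · rw [h]
  · apply Adj.reachable
    refine ⟨fun h' => h (Fin.ext h'.symm), Or.inl rfl⟩

lemma fan_nbr (k : ℕ) (i : Fin (k + 6)) (s : Finset ℕ) (hs : ∀ a ∈ s, a < k + 6)
    (h : ∀ a < k + 6, a ∈ s ↔ (i.1 ≠ a ∧ (i.1 = 0 ∨ a = 0 ∨ (i.1 = 1 ∧ a ≤ 4) ∨ (a = 1 ∧ i.1 ≤ 4) ∨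
    (i.1 = 2 ∧ a = 3) ∨ (i.1 = 3 ∧ a = 2)))) :
    ((fanGraph (k + 6)).neighborSet i).ncard = s.card := by
  rw [← Set.ncard_coe_finset, ← Set.ncard_image_of_injective _ Fin.val_injective]
  congr 1
  ext a
  simp only [Set.mem_image, Finset.mem_coe, mem_neighborSet]
  constructor
  · rintro ⟨x, hx, rfl⟩
    exact (h x x.2).2 hx
  · intro ha
    exact ⟨⟨a, hs a ha⟩, (h a (hs a ha)).1 ha, rfl⟩

lemma fan_deg (k : ℕ) (i : Fin (k + 6)) :
    ((fanGraph (k + 6)).neighborSet i).ncard =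
      (if i.1 = 0 then k + 6 - 1 else if i.1 = 1 then 4 else
          if i.1 < 4 then 3 else if i.1 = 4 then 2 else 1) := by
  split_ifs with h0 h1 h2 h3
  · rw [fan_nbr k i ((Finset.range (k + 6)).erase 0) (by simp) (by
      intro a ha
      simp only [Finset.mem_erase, Finset.mem_range]
      omega)]
    simp
  · rw [fan_nbr k i {0, 2, 3, 4} (by simp) (by
      intro a ha
      simp only [Finset.mem_insert, Finset.mem_singleton]
      omega)]
    simp
  · rcases (show i.1 = 2 ∨ i.1 = 3 by omega) with h | h
    · rw [fan_nbr k i {0, 1, 3} (by simp) (by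
      intro a ha
      simp only [Finset.mem_insert, Finset.mem_singleton]
      omega)]
      simp
    · rw [fan_nbr k i {0, 1, 2} (by simp) (by
      intro a ha
      simp only [Finset.mem_insert, Finset.mem_singleton]
      omega)]
      simp
  · rw [fan_nbr k i {0, 1} (by simp) (by
      intro a ha
      simp only [Finset.mem_insert, Finset.mem_singleton]
      omega)]
    simp
  · rw [fan_nbr k i {0} (by simp) (by
      intro a ha
      simp only [Finset.mem_insert, Finset.mem_singleton]
      omega)]
    simp

/-- Bounds for the inverse degree of a tetracyclic graph:
`(n-2)/2 ≤ ρ(G) ≤ (n-5) + 1/(n-1) + 17/12`, with the lower bound attained by a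
tetracyclic graph with degree sequence `(3^6, 2^{n-6})` and the upper bound by a
tetracyclic graph with degree sequence `(n-1, 4, 3^2, 2, 1^{n-5})`. -/
theorem tetracyclic_inverse_degree_bounds (n : ℕ) (hn : 6 ≤ n)
    (G : SimpleGraph (Fin n)) (hconn : G.Connected)
    (hedges : G.edgeSet.ncard = n + 3) :
    (((n : ℝ) - 2) / 2 ≤ inverseDegree G ∧
      inverseDegree G ≤ ((n : ℝ) - 5) + 1 / ((n : ℝ) - 1) + 17 / 12) ∧
    (∃ H : SimpleGraph (Fin n), H.Connected ∧ H.edgeSet.ncard = n + 3 ∧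
      IsDegreeSequence H (fun i => if i < 6 then 3 else 2) ∧
      inverseDegree H = ((n : ℝ) - 2) / 2) ∧
    (∃ H : SimpleGraph (Fin n), H.Connected ∧ H.edgeSet.ncard = n + 3 ∧
      IsDegreeSequence H
        (fun i => if i = 0 then n - 1 else if i = 1 then 4 else
          if i < 4 then 3 else if i = 4 then 2 else 1) ∧
      inverseDegree H = ((n : ℝ) - 5) + 1 / ((n : ℝ) - 1) + 17 / 12) := by
  have hcard : Fintype.card (Fin n) = n := Fintype.card_fin n
  have hsum := ncard_nbr_sum G
  rw [hedges] at hsum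
  obtain ⟨k, rfl⟩ : ∃ k, n = k + 6 := ⟨n - 6, by omega⟩
  refine ⟨⟨?_, ?_⟩, ?_, ?_⟩
  · have := lower G (ncard_nbr_pos hconn) (by rw [hcard]; exact hsum)
    rw [hcard] at this
    exact this
  · have := upper (k + 1) (Fin (k + 6)) G (by rw [hcard]) hconn (by rw [hsum]; ring)
    unfold inverseDegree
    refine this.trans (le_of_eq ?_)
    push_cast
    rw [show (k : ℝ) + 6 - 1 = k + 1 + 4 by ring]
    ring
  · refine ⟨cycleGraph (k + 6) ⊔ chordGraph (k + 6), ?_, ?_, ?_, ?_⟩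
    · exact (cycleGraph_connected (n := k + 5)).mono le_sup_left
    · apply edges_of_deg _ (fun i => if i < 6 then 3 else 2) (chord_deg k)
      rw [add_comm k 6, Finset.sum_range_add]
      simp [Finset.sum_range_succ]
      ring
    · exact ⟨Equiv.refl _, chord_deg k⟩
    · rw [inv_of_deg _ (fun i => if i < 6 then 3 else 2) (chord_deg k)]
      rw [add_comm k 6, Finset.sum_range_add]
      simp [Finset.sum_range_succ]
      ring
  · refine ⟨fanGraph (k + 6), fan_conn k, ?_, ⟨Equiv.refl _, fan_deg k⟩, ?_⟩
    · apply edges_of_deg _ (fun i => if i = 0 then k + 6 - 1 else if i = 1 then 4 else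
          if i < 4 then 3 else if i = 4 then 2 else 1) (fan_deg k)
      have tail : ∀ x : ℕ, (if 6 + x = 0 then k + 6 - 1 else if 6 + x = 1 then 4 else
          if 6 + x < 4 then 3 else if 6 + x = 4 then 2 else 1) = 1 := fun x => by
        rw [if_neg (by omega), if_neg (by omega), if_neg (by omega), if_neg (by omega)]
      rw [add_comm k 6] at *
      rw [Finset.sum_range_add]
      simp_rw [tail]
      simp [Finset.sum_range_succ]
      omega
    · rw [inv_of_deg _ (fun i => if i = 0 then k + 6 - 1 else if i = 1 then 4 else
          if i < 4 then 3 else if i = 4 then 2 else 1) (fan_deg k)]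
      have tail : ∀ x : ℕ, (if 6 + x = 0 then k + 6 - 1 else if 6 + x = 1 then 4 else
          if 6 + x < 4 then 3 else if 6 + x = 4 then 2 else 1) = 1 := fun x => by
        rw [if_neg (by omega), if_neg (by omega), if_neg (by omega), if_neg (by omega)]
      rw [add_comm k 6] at *
      rw [Finset.sum_range_add]
      simp_rw [tail]
      simp [Finset.sum_range_succ]
      ring
end
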